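/- arXiv:2512.20596 — 2 statements merged into one kernel-verified Lean document; each statement's English description precedes it below -/
import Mathlib

section
/- Let T be a nonsingular ergodic automorphism of a standard Borel probability space (X, μ) that admits a weakly wandering set of positive measure. Then for every measurable set A ⊆ X and every ε > 0 there exists a measurable set V ⊆ A with V ∈ V(T) and μ(A \ V) < ε; in particular, every measurable set can be approximated arbitrarily well in the pseudometric (A, B) ↦ μ(A Δ B) by elements of V(T). -/
open MeasureTheory Filter Set
open scoped ENNReal symmDiff

/-- `T` is a nonsingular automorphism of `(X, μ)`. -/
def Nonsingular {X : Type*} [MeasurableSpace X] (μ : Measure X) (T : Equiv.Perm X) : Prop :=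
  Measurable T ∧ Measurable T.symm ∧
    ∀ A : Set X, MeasurableSet A → (μ (⇑T ⁻¹' A) = 0 ↔ μ A = 0)

/-- `T` is ergodic: any measurable set `A` with `μ(T⁻¹(A) Δ A) = 0` has measure `0` or `1`. -/
def ErgodicNS {X : Type*} [MeasurableSpace X] (μ : Measure X) (T : Equiv.Perm X) : Prop :=
  ∀ A : Set X, MeasurableSet A → μ ((⇑T ⁻¹' A) ∆ A) = 0 → μ A = 0 ∨ μ A = 1

/-- `W` is weakly wandering for `T`. -/
def WeaklyWandering {X : Type*} [MeasurableSpace X] (μ : Measure X) (T : Equiv.Perm X)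
    (W : Set X) : Prop :=
  ∃ k : ℕ → ℕ, k 0 = 0 ∧ StrictMono k ∧
    ∀ i j : ℕ, i ≠ j → μ (⇑(T ^ k i) '' W ∩ ⇑(T ^ k j) '' W) = 0

/-- `V(T)`: measurable sets whose Cesàro averages of measures of forward iterates tend to 0. -/
def VT {X : Type*} [MeasurableSpace X] (μ : Measure X) (T : Equiv.Perm X) : Set (Set X) :=
  {A | MeasurableSet A ∧
    Tendsto (fun n : ℕ => (∑ k ∈ Finset.range n, (μ (⇑(T ^ k) '' A)).toReal) / n)
      atTop (nhds 0)}

theorem tendsto_div_zero_of_mul_le {S : ℕ → ℝ} (h0 : ∀ n, 0 ≤ S n)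
    (h : ∀ N : ℕ, ∃ C : ℝ, ∀ n : ℕ, N * S n ≤ n + C) :
    Tendsto (fun n : ℕ => S n / n) atTop (nhds 0) := by
  rw [Metric.tendsto_atTop]
  intro ε hε
  obtain ⟨N, hN⟩ := exists_nat_gt (2 / ε)
  obtain ⟨C, hC⟩ := h N
  obtain ⟨M, hM⟩ := exists_nat_gt C
  refine ⟨M + 1, fun n hn => ?_⟩
  have hnM : (M : ℝ) + 1 ≤ n := by exact_mod_cast hn
  have hn0 : (0 : ℝ) < n := lt_of_lt_of_le (by positivity) hnM
  have hN0 : (0 : ℝ) < N := lt_trans (by positivity) hN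
  rw [Real.dist_eq, sub_zero, abs_of_nonneg (div_nonneg (h0 n) hn0.le), div_lt_iff₀ hn0]
  rw [div_lt_iff₀ hε] at hN
  have h1 := hC n
  have h2 : (2 : ℝ) * n < N * ε * n := mul_lt_mul_of_pos_right hN hn0
  exact lt_of_mul_lt_mul_left (by linarith [mul_assoc (N : ℝ) ε n]) hN0.le

section

variable {X : Type*} [MeasurableSpace X] {μ : Measure X} {T : Equiv.Perm X}

theorem Equiv.Perm.measurable_pow_symm (h : Measurable T.symm) (k : ℕ) :
    Measurable (T ^ k).symm := by
  have : ⇑(T ^ k).symm = (⇑T.symm)^[k] := by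
    rw [Equiv.Perm.iterate_eq_pow T.symm k]
    exact congrArg DFunLike.coe (inv_pow T k).symm
  rw [this]
  exact h.iterate k

theorem Nonsingular.measurableSet_pow_image (hT : Nonsingular μ T) (k : ℕ) {A : Set X}
    (hA : MeasurableSet A) : MeasurableSet (⇑(T ^ k) '' A) := by
  rw [Equiv.image_eq_preimage_symm]
  exact Equiv.Perm.measurable_pow_symm hT.2.1 k hA

theorem Nonsingular.measure_pow_image_eq_zero (hT : Nonsingular μ T) (k : ℕ) {A : Set X}
    (hA : MeasurableSet A) (h : μ A = 0) : μ (⇑(T ^ k) '' A) = 0 := by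
  induction k with
  | zero => simpa using h
  | succ k ih =>
    rw [← hT.2.2 _ (hT.measurableSet_pow_image (k + 1) hA), pow_succ', Equiv.Perm.coe_mul,
      image_comp, preimage_image_eq _ T.injective]
    exact ih

/-- A weakly wandering measurable set has Cesàro averages tending to zero. -/
theorem WeaklyWandering.mem_VT [IsProbabilityMeasure μ] (hT : Nonsingular μ T) {W : Set X}
    (hWm : MeasurableSet W) (hW : WeaklyWandering μ T W) : W ∈ VT μ T := by
  obtain ⟨k, -, -, hk⟩ := hW
  refine ⟨hWm, tendsto_div_zero_of_mul_le
    (fun n => Finset.sum_nonneg fun _ _ => ENNReal.toReal_nonneg) fun N => ?_⟩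
  set a : ℕ → ℝ := fun m => (μ (⇑(T ^ m) '' W)).toReal with ha
  have ha0 : ∀ m, 0 ≤ a m := fun m => ENNReal.toReal_nonneg
  have ha1 : ∀ m, a m ≤ 1 := fun m => measureReal_le_one
  have hsum : ∀ m, ∑ i ∈ Finset.range N, a (m + k i) ≤ 1 := by
    intro m
    have hd : Set.Pairwise (↑(Finset.range N))
        (Function.onFun (AEDisjoint μ) fun i => ⇑(T ^ (m + k i)) '' W) := by
      intro i _ j _ hij
      have himg : ∀ l, ⇑(T ^ (m + l)) '' W = ⇑(T ^ m) '' (⇑(T ^ l) '' W) := by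
        intro l
        rw [pow_add, Equiv.Perm.coe_mul, image_comp]
      simp only [Function.onFun, AEDisjoint, himg]
      rw [← image_inter (T ^ m).injective]
      exact hT.measure_pow_image_eq_zero m
        ((hT.measurableSet_pow_image _ hWm).inter (hT.measurableSet_pow_image _ hWm)) (hk i j hij)
    have h := measure_biUnion_finset₀ hd
      fun i _ => (hT.measurableSet_pow_image (m + k i) hWm).nullMeasurableSet
    rw [ha, ← ENNReal.toReal_sum fun _ _ => measure_ne_top _ _, ← h]
    exact measureReal_le_one
  refine ⟨∑ i ∈ Finset.range N, (k i : ℝ), fun n => ?_⟩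
  have hshift : ∀ i, ∑ m ∈ Finset.range n, a m ≤ ∑ m ∈ Finset.range n, a (m + k i) + k i := by
    intro i
    calc ∑ m ∈ Finset.range n, a m ≤ ∑ m ∈ Finset.range (k i + n), a m :=
          Finset.sum_le_sum_of_subset_of_nonneg
            (Finset.range_subset_range.2 (Nat.le_add_left _ _)) fun m _ _ => ha0 m
      _ = ∑ m ∈ Finset.range (k i), a m + ∑ m ∈ Finset.range n, a (m + k i) := by
          simp only [Finset.sum_range_add, add_comm _ (k i)]
      _ ≤ k i + ∑ m ∈ Finset.range n, a (m + k i) := by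
          gcongr
          simpa using Finset.sum_le_sum fun m (_ : m ∈ Finset.range (k i)) => ha1 m
      _ = _ := add_comm _ _
  calc (N : ℝ) * ∑ m ∈ Finset.range n, a m
      = ∑ _i ∈ Finset.range N, ∑ m ∈ Finset.range n, a m := by simp
    _ ≤ ∑ i ∈ Finset.range N, (∑ m ∈ Finset.range n, a (m + k i) + k i) :=
        Finset.sum_le_sum fun i _ => hshift i
    _ = ∑ m ∈ Finset.range n, ∑ i ∈ Finset.range N, a (m + k i)
        + ∑ i ∈ Finset.range N, (k i : ℝ) := by
        rw [Finset.sum_add_distrib, Finset.sum_comm]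
    _ ≤ n + ∑ i ∈ Finset.range N, (k i : ℝ) := by
        gcongr
        simpa using Finset.sum_le_sum fun m (_ : m ∈ Finset.range n) => hsum m

/-- A measurable set belongs to `VT μ T` as soon as the partial sums of the measures of its
iterates exceed those of a member of `VT μ T` by at most `1`. -/
theorem VT.mem_of_sum_le {A B : Set X} (hA : A ∈ VT μ T) (hB : MeasurableSet B)
    (h : ∀ n, ∑ k ∈ Finset.range n, (μ (⇑(T ^ k) '' B)).toReal
      ≤ ∑ k ∈ Finset.range n, (μ (⇑(T ^ k) '' A)).toReal + 1) : B ∈ VT μ T := by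
  refine ⟨hB, squeeze_zero
    (fun n => div_nonneg (Finset.sum_nonneg fun _ _ => ENNReal.toReal_nonneg) n.cast_nonneg)
    (fun n => div_le_div_of_nonneg_right (h n) n.cast_nonneg) ?_⟩
  simp only [add_div]
  simpa using hA.2.add tendsto_one_div_atTop_nhds_zero_nat

theorem VT.mono [IsFiniteMeasure μ] {A B : Set X} (hA : A ∈ VT μ T) (hB : MeasurableSet B)
    (h : B ⊆ A) : B ∈ VT μ T := by
  refine VT.mem_of_sum_le hA hB fun n => ?_
  have := Finset.sum_le_sum fun k (_ : k ∈ Finset.range n) =>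
    measureReal_mono (μ := μ) (image_mono (f := ⇑(T ^ k)) h)
  exact this.trans (le_add_of_nonneg_right zero_le_one)

theorem VT.union [IsFiniteMeasure μ] {A B : Set X} (hA : A ∈ VT μ T) (hB : B ∈ VT μ T) :
    A ∪ B ∈ VT μ T := by
  refine ⟨hA.1.union hB.1, squeeze_zero
    (fun n => div_nonneg (Finset.sum_nonneg fun _ _ => ENNReal.toReal_nonneg) n.cast_nonneg)
    (fun n => ?_) (by simpa using hA.2.add hB.2)⟩
  rw [← add_div, ← Finset.sum_add_distrib]
  refine div_le_div_of_nonneg_right (Finset.sum_le_sum fun k _ => ?_) n.cast_nonneg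
  rw [image_union]
  exact measureReal_union_le _ _

theorem VT.image [IsProbabilityMeasure μ] (hT : Nonsingular μ T) {A : Set X}
    (hA : A ∈ VT μ T) : ⇑T '' A ∈ VT μ T := by
  refine VT.mem_of_sum_le hA (by simpa using hT.measurableSet_pow_image 1 hA.1) fun n => ?_
  simp only [← image_comp, ← Equiv.Perm.coe_mul, ← pow_succ]
  have h1 := Finset.sum_range_succ (fun k => (μ (⇑(T ^ k) '' A)).toReal) n
  have h2 := Finset.sum_range_succ' (fun k => (μ (⇑(T ^ k) '' A)).toReal) n
  have h3 : (μ (⇑(T ^ n) '' A)).toReal ≤ 1 := measureReal_le_one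
  have h4 : 0 ≤ (μ (⇑(T ^ 0) '' A)).toReal := ENNReal.toReal_nonneg
  linarith

theorem VT.preimage [IsProbabilityMeasure μ] (hT : Nonsingular μ T) {A : Set X}
    (hA : A ∈ VT μ T) : ⇑T ⁻¹' A ∈ VT μ T := by
  refine VT.mem_of_sum_le hA (hT.1 hA.1) fun n => ?_
  have h1 := Finset.sum_range_succ (fun k => (μ (⇑(T ^ k) '' (⇑T ⁻¹' A))).toReal) n
  have h2 := Finset.sum_range_succ' (fun k => (μ (⇑(T ^ k) '' (⇑T ⁻¹' A))).toReal) n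
  have h3 : (μ (⇑(T ^ 0) '' (⇑T ⁻¹' A))).toReal ≤ 1 := measureReal_le_one
  have h4 : 0 ≤ (μ (⇑(T ^ n) '' (⇑T ⁻¹' A))).toReal := ENNReal.toReal_nonneg
  have h5 : ∀ k, ⇑(T ^ (k + 1)) '' (⇑T ⁻¹' A) = ⇑(T ^ k) '' A := by
    intro k
    rw [pow_succ, Equiv.Perm.coe_mul, image_comp, image_preimage_eq _ T.surjective]
  simp only [h5] at h2
  linarith

/-- If an ergodic `T` has a member of `VT μ T` of positive measure, then the space is exhausted
by an increasing sequence of members of `VT μ T`. -/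
theorem VT.exists_monotone_exhaustion [IsProbabilityMeasure μ] (hT : Nonsingular μ T)
    (hTerg : ErgodicNS μ T) {W : Set X} (hW : W ∈ VT μ T) (hpos : 0 < μ W) :
    ∃ U : ℕ → Set X, Monotone U ∧ (∀ n, U n ∈ VT μ T) ∧ μ (⋃ n, U n)ᶜ = 0 := by
  let F : Set X → Set X := fun B => B ∪ (⇑T '' B ∪ ⇑T ⁻¹' B)
  let U : ℕ → Set X := fun n => F^[n] W
  have hsucc : ∀ n, U (n + 1) = U n ∪ (⇑T '' U n ∪ ⇑T ⁻¹' U n) := fun n =>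
    Function.iterate_succ_apply' F n W
  have hU : ∀ n, U n ∈ VT μ T := by
    intro n
    induction n with
    | zero => exact hW
    | succ n ih =>
      rw [hsucc]
      exact VT.union ih (VT.union (VT.image hT ih) (VT.preimage hT ih))
  refine ⟨U, monotone_nat_of_le_succ fun n => hsucc n ▸ subset_union_left, hU, ?_⟩
  have hm : MeasurableSet (⋃ n, U n) := MeasurableSet.iUnion fun n => (hU n).1
  have hinv : ⇑T ⁻¹' (⋃ n, U n) = ⋃ n, U n := by
    ext x
    simp only [mem_preimage, mem_iUnion]
    constructor
    · rintro ⟨n, hn⟩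
      exact ⟨n + 1, hsucc n ▸ Or.inr (Or.inr hn)⟩
    · rintro ⟨n, hn⟩
      exact ⟨n + 1, hsucc n ▸ Or.inr (Or.inl (mem_image_of_mem T hn))⟩
  rw [prob_compl_eq_zero_iff hm]
  refine (hTerg _ hm (by simp [hinv])).resolve_left fun h => ?_
  exact hpos.ne' (measure_mono_null (subset_iUnion U 0) h)

theorem VT.exists_subset_measure_diff_lt [IsProbabilityMeasure μ] (hT : Nonsingular μ T)
    (hTerg : ErgodicNS μ T) {W : Set X} (hW : W ∈ VT μ T) (hpos : 0 < μ W)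
    {A : Set X} (hA : MeasurableSet A) {ε : ℝ≥0∞} (hε : 0 < ε) :
    ∃ V ∈ VT μ T, V ⊆ A ∧ μ (A \ V) < ε := by
  obtain ⟨U, hmono, hU, hnull⟩ := VT.exists_monotone_exhaustion hT hTerg hW hpos
  have hlim : Tendsto (fun n => μ (A \ U n)) atTop (nhds (μ (⋂ n, A \ U n))) :=
    tendsto_measure_iInter_atTop (fun n => (hA.diff (hU n).1).nullMeasurableSet)
      (fun _ _ h => sdiff_subset_sdiff_right (hmono h)) ⟨0, measure_ne_top _ _⟩
  have hzero : μ (⋂ n, A \ U n) = 0 := by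
    refine measure_mono_null (fun x hx => ?_) hnull
    simp only [mem_iInter, Set.mem_sdiff] at hx
    simpa using fun n => (hx n).2
  rw [hzero] at hlim
  obtain ⟨n, hn⟩ := (hlim.eventually_lt_const hε).exists
  exact ⟨A ∩ U n, VT.mono (hU n) (hA.inter (hU n).1) inter_subset_right, inter_subset_left,
    by rwa [sdiff_self_inter]⟩

end

/-- **`V(T)` is dense.**  Let `T` be a nonsingular ergodic automorphism of a standard Borel
probability space `(X, μ)` admitting a weakly wandering set of positive measure.  Then every
measurable set `A` contains, up to measure `< ε`, a set `V ∈ V(T)`; in particular every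
measurable set is approximated arbitrarily well in the pseudometric `μ(· Δ ·)` by elements
of `V(T)`. -/
theorem VT_dense {X : Type*} [MeasurableSpace X] [StandardBorelSpace X]
    (μ : Measure X) [IsProbabilityMeasure μ] (T : Equiv.Perm X)
    (hT : Nonsingular μ T) (hTerg : ErgodicNS μ T)
    (hW : ∃ W : Set X, MeasurableSet W ∧ WeaklyWandering μ T W ∧ 0 < μ W) :
    (∀ A : Set X, MeasurableSet A → ∀ ε : ℝ≥0∞, 0 < ε →
      ∃ V ∈ VT μ T, V ⊆ A ∧ μ (A \ V) < ε) ∧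
    (∀ A : Set X, MeasurableSet A → ∀ ε : ℝ≥0∞, 0 < ε →
      ∃ V ∈ VT μ T, μ (A ∆ V) < ε) := by
  obtain ⟨W, hWm, hWw, hpos⟩ := hW
  have key := fun (A : Set X) (hA : MeasurableSet A) (ε : ℝ≥0∞) (hε : 0 < ε) =>
    VT.exists_subset_measure_diff_lt hT hTerg (hWw.mem_VT hT hWm) hpos hA hε
  refine ⟨key, fun A hA ε hε => ?_⟩
  obtain ⟨V, hV, hVA, hlt⟩ := key A hA ε hε
  refine ⟨V, hV, ?_⟩
  rwa [Set.symmDiff_def, sdiff_eq_empty.2 hVA, union_empty]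
end

section
/- For a generic ρ ∈ Hom_σ(Γ, Sym(ℤ)), the action of Γ on ℤ via ρ is faithful, highly transitive (for every k ≥ 1 and any two ordered k-tuples of pairwise distinct integers there exists γ ∈ Γ with ρ(γ) mapping the first tuple to the second), and amenable in the sense of Greenleaf (for every finite subset F ⊆ Γ and every ε > 0 there exists a finite nonempty set A ⊆ ℤ with |ρ(γ)(A) Δ A| < ε·|A| for every γ ∈ F). -/
open Filter Set
open scoped symmDiff

/-- Pointwise-convergence topology on `Sym(ℤ)` (with `ℤ` discrete). -/
instance permIntTopology : TopologicalSpace (Equiv.Perm ℤ) :=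
  TopologicalSpace.induced (fun g : Equiv.Perm ℤ => (g : ℤ → ℤ)) inferInstance

/-- The shift `σ : n ↦ n + 1`. -/
def shiftPerm : Equiv.Perm ℤ := Equiv.addRight 1

/-- Pointwise-convergence topology on the space of homomorphisms `Γ → Sym(ℤ)`. -/
instance homTopology {ι : Type*} : TopologicalSpace (FreeGroup ι →* Equiv.Perm ℤ) :=
  TopologicalSpace.induced (fun ρ => (ρ : FreeGroup ι → Equiv.Perm ℤ)) inferInstance

/-- `Hom_σ(Γ, Sym(ℤ))`: homomorphisms sending the distinguished free generator `a₀` to the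
shift `σ`, with the subspace (= pointwise convergence) topology. -/
abbrev HomSigma {ι : Type*} (a₀ : ι) : Type _ :=
  {ρ : FreeGroup ι →* Equiv.Perm ℤ // ρ (FreeGroup.of a₀) = shiftPerm}

/-- A finite relation which is functional and injective extends to a finitely supported
permutation. -/
theorem exists_perm_extending_finset (R : Finset (ℤ × ℤ))
    (hR : ∀ p ∈ R, ∀ q ∈ R, p.1 = q.1 ↔ p.2 = q.2) :
    ∃ τ : Equiv.Perm ℤ, {n | τ n ≠ n}.Finite ∧ ∀ p ∈ R, τ p.1 = p.2 := by
  classical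
  induction R using Finset.induction_on with
  | empty => exact ⟨1, by simp, by simp⟩
  | insert p R _ ih =>
    obtain ⟨τ, hfin, hτ⟩ := ih fun q hq r hr =>
      hR q (Finset.mem_insert_of_mem hq) r (Finset.mem_insert_of_mem hr)
    refine ⟨Equiv.swap (τ p.1) p.2 * τ, ?_, ?_⟩
    · refine (hfin.union (Set.toFinite {τ p.1, p.2})).subset fun n hn => ?_
      by_contra hcon
      simp only [Set.mem_union, Set.mem_ofPred_eq, Set.mem_insert_iff, Set.mem_singleton_iff,
        not_or, not_not] at hcon
      obtain ⟨h1, h2, h3⟩ := hcon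
      exact hn (by rw [Equiv.Perm.mul_apply, h1, Equiv.swap_apply_of_ne_of_ne h2 h3])
    · intro q hq
      rw [Equiv.Perm.mul_apply]
      by_cases hqp : q.1 = p.1
      · rw [(hR q hq p (Finset.mem_insert_self _ _)).1 hqp, hqp, Equiv.swap_apply_left]
      · have hqR : q ∈ R := (Finset.mem_insert.1 hq).resolve_left fun h => hqp (by rw [h])
        rw [Equiv.swap_apply_of_ne_of_ne, hτ q hqR]
        · exact fun h => hqp (τ.injective h)
        · rw [hτ q hqR]
          exact fun h => hqp ((hR q hq p (Finset.mem_insert_self _ _)).2 h)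

section HomSigma

variable {ι : Type*} {a₀ : ι}

theorem HomSigma.continuous_apply (γ : FreeGroup ι) (n : ℤ) :
    Continuous fun ρ : HomSigma a₀ => ρ.1 γ n := by
  have h1 : Continuous fun g : Equiv.Perm ℤ => (g : ℤ → ℤ) := continuous_induced_dom
  have h2 : Continuous fun ρ : FreeGroup ι →* Equiv.Perm ℤ => (ρ : FreeGroup ι → Equiv.Perm ℤ) :=
    continuous_induced_dom
  exact (_root_.continuous_apply n).comp
    (h1.comp ((_root_.continuous_apply γ).comp (h2.comp continuous_subtype_val)))

theorem HomSigma.isOpen_apply_eq (γ : FreeGroup ι) (n m : ℤ) :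
    IsOpen {ρ : HomSigma a₀ | ρ.1 γ n = m} :=
  (isOpen_discrete {m}).preimage (HomSigma.continuous_apply γ n)

/-- Prescribing finitely many values of the generators gives a neighbourhood basis. -/
theorem HomSigma.exists_finset_of_mem_nhds {ρ₀ : HomSigma a₀} {U : Set (HomSigma a₀)}
    (hU : U ∈ nhds ρ₀) :
    ∃ D : Finset (ι × ℤ), ∀ ρ : HomSigma a₀,
      (∀ p ∈ D, ρ.1 (FreeGroup.of p.1) p.2 = ρ₀.1 (FreeGroup.of p.1) p.2) → ρ ∈ U := by
  set s : ι × ℤ → Set (HomSigma a₀) :=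
    fun p => {ρ | ρ.1 (FreeGroup.of p.1) p.2 = ρ₀.1 (FreeGroup.of p.1) p.2}
  set l : Filter (HomSigma a₀) := ⨅ p, 𝓟 (s p)
  have hgen : ∀ (b : ι) (n : ℤ),
      ∀ᶠ ρ in l, ρ.1 (FreeGroup.of b) n = ρ₀.1 (FreeGroup.of b) n := fun b n =>
    mem_iInf_of_mem (b, n) (mem_principal_self (s (b, n)))
  have heval : ∀ (γ : FreeGroup ι) (n : ℤ), ∀ᶠ ρ in l, ρ.1 γ n = ρ₀.1 γ n := by
    intro γ
    induction γ using FreeGroup.induction_on with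
    | C1 => simp
    | of b => exact hgen b
    | inv_of b _ =>
      intro n
      filter_upwards [hgen b ((ρ₀.1 (FreeGroup.of b))⁻¹ n)] with ρ hρ
      rw [map_inv, map_inv, Equiv.Perm.inv_eq_iff_eq, hρ]
      simp
    | mul g h hg hh =>
      intro n
      filter_upwards [hh n, hg (ρ₀.1 h n)] with ρ h1 h2
      rw [map_mul, map_mul, Equiv.Perm.mul_apply, Equiv.Perm.mul_apply, h1, h2]
  have hle : l ≤ nhds ρ₀ := by
    have hind : Topology.IsInducing (Subtype.val : HomSigma a₀ → FreeGroup ι →* Equiv.Perm ℤ) :=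
      ⟨rfl⟩
    rw [← tendsto_id', hind.nhds_eq_comap, tendsto_comap_iff, nhds_induced,
      tendsto_comap_iff, tendsto_pi_nhds]
    intro γ
    rw [nhds_induced, tendsto_comap_iff, tendsto_pi_nhds]
    intro n
    rw [nhds_discrete, tendsto_pure]
    exact heval γ n
  obtain ⟨t, ht, htU⟩ := (hasBasis_iInf_principal_finite s).mem_iff.1 (hle hU)
  refine ⟨ht.toFinset, fun ρ hρ => htU (Set.mem_iInter₂.2 fun p hp => ?_)⟩
  exact hρ p (ht.mem_toFinset.2 hp)

/-- Inside any neighbourhood one finds a representation whose free generators are finitely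
supported and satisfy arbitrary finite constraints far away from the origin. -/
theorem HomSigma.exists_mem_of_constraints {ρ₀ : HomSigma a₀} {U : Set (HomSigma a₀)}
    (hU : U ∈ nhds ρ₀) :
    ∃ N : ℤ, ∀ R : ι → Finset (ℤ × ℤ),
      (∀ b, ∀ p ∈ R b, ∀ q ∈ R b, p.1 = q.1 ↔ p.2 = q.2) →
      (∀ b, ∀ p ∈ R b, N < p.1 ∧ N < p.2) →
      ∃ ρ ∈ U, ∀ b, b ≠ a₀ →
        {n | ρ.1 (FreeGroup.of b) n ≠ n}.Finite ∧
        ∀ p ∈ R b, ρ.1 (FreeGroup.of b) p.1 = p.2 := by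
  classical
  obtain ⟨D, hD⟩ := HomSigma.exists_finset_of_mem_nhds hU
  obtain ⟨N₁, hN₁⟩ := (D.image Prod.snd).bddAbove
  obtain ⟨N₂, hN₂⟩ := (D.image fun p => ρ₀.1 (FreeGroup.of p.1) p.2).bddAbove
  refine ⟨max N₁ N₂, fun R hR hRN => ?_⟩
  set Q : ι → Finset (ℤ × ℤ) := fun b =>
    ((D.filter fun p => p.1 = b).image fun p => (p.2, ρ₀.1 (FreeGroup.of b) p.2))
  have hQN : ∀ b, ∀ p ∈ Q b, p.1 ≤ max N₁ N₂ ∧ p.2 ≤ max N₁ N₂ ∧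
      p.2 = ρ₀.1 (FreeGroup.of b) p.1 := by
    intro b p hp
    obtain ⟨⟨c, n⟩, hq, rfl⟩ := Finset.mem_image.1 hp
    obtain ⟨hcn, rfl⟩ := Finset.mem_filter.1 hq
    have h1 := hN₁ (Finset.mem_coe.2 (Finset.mem_image_of_mem _ hcn))
    have h2 := hN₂ (Finset.mem_coe.2 (Finset.mem_image_of_mem _ hcn))
    exact ⟨le_max_of_le_left h1, le_max_of_le_right h2, rfl⟩
  have key : ∀ b, ∃ τ : Equiv.Perm ℤ, {n | τ n ≠ n}.Finite ∧ ∀ p ∈ Q b ∪ R b, τ p.1 = p.2 := by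
    intro b
    refine exists_perm_extending_finset _ fun p hp q hq => ?_
    rcases Finset.mem_union.1 hp with hp | hp <;> rcases Finset.mem_union.1 hq with hq | hq
    · rw [(hQN b p hp).2.2, (hQN b q hq).2.2, EmbeddingLike.apply_eq_iff_eq]
    · have h1 := hQN b p hp
      have h2 := hRN b q hq
      constructor <;> intro h <;> omega
    · have h1 := hQN b q hq
      have h2 := hRN b p hp
      constructor <;> intro h <;> omega
    · exact hR b p hp q hq
  choose τ hτfin hτ using key
  let ρ : HomSigma a₀ :=
    ⟨FreeGroup.lift fun b => if b = a₀ then shiftPerm else τ b, by simp⟩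
  have hρ : ∀ b, b ≠ a₀ → ρ.1 (FreeGroup.of b) = τ b := fun b hb => by simp [ρ, hb]
  refine ⟨ρ, hD ρ fun p hp => ?_, fun b hb => ?_⟩
  · by_cases hpa : p.1 = a₀
    · rw [hpa, ρ.2, ρ₀.2]
    · rw [hρ _ hpa]
      exact hτ p.1 (p.2, _) (Finset.mem_union_left _
        (Finset.mem_image.2 ⟨p, Finset.mem_filter.2 ⟨hp, rfl⟩, rfl⟩))
  · rw [hρ b hb]
    exact ⟨hτfin b, fun p hp => hτ b p (Finset.mem_union_right _ hp)⟩

/-- If `j` intertwines left multiplication by generators with `ρ` on a suitable finite set, then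
it intertwines left multiplication by `g` with `ρ g` at `x`. -/
theorem exists_finset_intertwining (g x : FreeGroup ι) :
    ∃ P : Finset (FreeGroup ι), x ∈ P ∧ g * x ∈ P ∧
      ∀ (j : FreeGroup ι → ℤ) (ρ : FreeGroup ι →* Equiv.Perm ℤ),
        (∀ b, ∀ y ∈ P, FreeGroup.of b * y ∈ P →
          ρ (FreeGroup.of b) (j y) = j (FreeGroup.of b * y)) →
        ρ g (j x) = j (g * x) := by
  classical
  induction g using FreeGroup.induction_on generalizing x with
  | C1 => exact ⟨{x}, by simp, by simp, by simp⟩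
  | of b =>
    exact ⟨{x, FreeGroup.of b * x}, by simp, by simp, fun j ρ h => h b x (by simp) (by simp)⟩
  | inv_of b _ =>
    refine ⟨{x, (FreeGroup.of b)⁻¹ * x}, by simp, by simp, fun j ρ h => ?_⟩
    have := h b ((FreeGroup.of b)⁻¹ * x) (by simp) (by simp)
    rw [map_inv, Equiv.Perm.inv_eq_iff_eq, this, mul_inv_cancel_left]
  | mul g h hg hh =>
    obtain ⟨P, hP1, -, hP⟩ := hh x
    obtain ⟨Q, -, hQ2, hQ⟩ := hg (h * x)
    refine ⟨P ∪ Q, Finset.mem_union_left _ hP1,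
      Finset.mem_union_right _ (by rwa [mul_assoc]), fun j ρ hj => ?_⟩
    rw [map_mul, Equiv.Perm.mul_apply,
      hP j ρ fun b y hy hby => hj b y (Finset.mem_union_left _ hy) (Finset.mem_union_left _ hby),
      hQ j ρ fun b y hy hby => hj b y (Finset.mem_union_right _ hy) (Finset.mem_union_right _ hby),
      mul_assoc]

/-- A finite subset of the free group embeds in `ℤ`, arbitrarily far to the right, in such a way
that left multiplication by the generator `a₀` becomes the shift. -/
theorem exists_injOn_shift_equivariant [Countable ι] (a₀ : ι) (P : Finset (FreeGroup ι)) (N : ℤ) :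
    ∃ j : FreeGroup ι → ℤ, Set.InjOn j P ∧ (∀ x ∈ P, N < j x) ∧
      ∀ x, j (FreeGroup.of a₀ * x) = j x + 1 := by
  classical
  let e : FreeGroup ι →* Multiplicative ℤ :=
    FreeGroup.lift fun b => Multiplicative.ofAdd (if b = a₀ then 1 else 0)
  have he : e (FreeGroup.of a₀) = Multiplicative.ofAdd 1 := by simp [e]
  obtain ⟨idx, hidx⟩ := exists_injective_nat
    (Quotient (MulAction.orbitRel (Subgroup.zpowers (FreeGroup.of a₀)) (FreeGroup ι)))
  obtain ⟨M, hM⟩ := (P.image fun x => |(e x).toAdd|).bddAbove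
  have hM' : ∀ x ∈ P, |(e x).toAdd| ≤ M := fun x hx =>
    hM (Finset.mem_coe.2 (Finset.mem_image_of_mem (fun x => |(e x).toAdd|) hx))
  set C : ℤ := 2 * |M| + |N| + 1 with hC
  refine ⟨fun x => (e x).toAdd + C * (idx (Quotient.mk _ x) + 1), ?_, ?_, ?_⟩
  · intro x hx y hy hxy
    have hx' := abs_le.1 (hM' x hx)
    have hy' := abs_le.1 (hM' y hy)
    have hMa := le_abs_self M
    have hNa := abs_nonneg N
    have hid : idx (Quotient.mk _ x) = idx (Quotient.mk _ y) := by
      simp only at hxy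
      generalize idx (Quotient.mk _ x) = i at hxy ⊢
      generalize idx (Quotient.mk _ y) = k at hxy ⊢
      rcases lt_trichotomy i k with h | h | h
      · have : (i : ℤ) + 1 ≤ k := by exact_mod_cast h
        nlinarith
      · exact h
      · have : (k : ℤ) + 1 ≤ i := by exact_mod_cast h
        nlinarith
    have hexy : e x = e y := by
      simp only [hid] at hxy
      exact Multiplicative.toAdd.injective (by linarith)
    obtain ⟨⟨u, hu⟩, hux⟩ := MulAction.orbitRel_apply.1 (Quotient.exact (hidx hid))
    obtain ⟨m, rfl⟩ := Subgroup.mem_zpowers_iff.1 hu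
    have hux' : FreeGroup.of a₀ ^ m * y = x := hux
    have hm : m = 0 := by
      have := congrArg (fun z => (e z).toAdd) hux'
      simpa [he, hexy] using this
    rw [← hux', hm, zpow_zero, one_mul]
  · intro x hx
    have hx' := abs_le.1 (hM' x hx)
    have hMa := le_abs_self M
    have hNa := le_abs_self N
    have hi : (0 : ℤ) ≤ idx (Quotient.mk _ x) := Int.natCast_nonneg _
    have hC0 : 0 ≤ C := by positivity
    have := mul_nonneg hC0 hi
    have hMn := abs_nonneg M
    linarith
  · intro x
    have hq : (Quotient.mk (MulAction.orbitRel (Subgroup.zpowers (FreeGroup.of a₀)) (FreeGroup ι))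
        (FreeGroup.of a₀ * x)) = Quotient.mk _ x :=
      Quotient.sound (MulAction.orbitRel_apply.2
        ⟨⟨FreeGroup.of a₀, Subgroup.mem_zpowers _⟩, rfl⟩)
    simp only [hq, map_mul, he, toAdd_mul, toAdd_ofAdd]
    ring

theorem HomSigma.dense_apply_ne [Countable ι] {γ : FreeGroup ι} (hγ : γ ≠ 1) :
    Dense {ρ : HomSigma a₀ | ∃ n, ρ.1 γ n ≠ n} := by
  classical
  refine dense_iff_inter_open.2 fun U hU ⟨ρ₀, hρ₀⟩ => ?_
  obtain ⟨N, hN⟩ := HomSigma.exists_mem_of_constraints (hU.mem_nhds hρ₀)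
  obtain ⟨P, h1P, hγP, hP⟩ := exists_finset_intertwining γ 1
  obtain ⟨j, hinj, hjN, hshift⟩ := exists_injOn_shift_equivariant a₀ P N
  obtain ⟨ρ, hρU, hρ⟩ := hN
    (fun b => (P.filter fun x => FreeGroup.of b * x ∈ P).image
      fun x => (j x, j (FreeGroup.of b * x)))
    (by
      intro b p hp q hq
      obtain ⟨x, hx, rfl⟩ := Finset.mem_image.1 hp
      obtain ⟨y, hy, rfl⟩ := Finset.mem_image.1 hq
      rw [Finset.mem_filter] at hx hy
      rw [hinj.eq_iff hx.1 hy.1, hinj.eq_iff hx.2 hy.2, mul_right_inj])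
    (by
      intro b p hp
      obtain ⟨x, hx, rfl⟩ := Finset.mem_image.1 hp
      rw [Finset.mem_filter] at hx
      exact ⟨hjN x hx.1, hjN _ hx.2⟩)
  refine ⟨ρ, hρU, j 1, ?_⟩
  rw [hP j ρ.1 fun b y hy hby => ?_]
  · exact fun h => hγ (by simpa using hinj hγP h1P h)
  · by_cases hb : b = a₀
    · rw [hb, ρ.2, hshift]
      rfl
    · exact (hρ b hb).2 _ (Finset.mem_image.2 ⟨y, Finset.mem_filter.2 ⟨hy, hby⟩, rfl⟩)

theorem shiftPerm_zpow_apply (m n : ℤ) : (shiftPerm ^ m) n = n + m := by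
  simp [shiftPerm]

theorem HomSigma.dense_map_tuple [Nontrivial ι] {k : ℕ} {x y : Fin k → ℤ}
    (hx : Function.Injective x) (hy : Function.Injective y) :
    Dense {ρ : HomSigma a₀ | ∃ γ : FreeGroup ι, ∀ i, ρ.1 γ (x i) = y i} := by
  classical
  refine dense_iff_inter_open.2 fun U hU ⟨ρ₀, hρ₀⟩ => ?_
  obtain ⟨N, hN⟩ := HomSigma.exists_mem_of_constraints (hU.mem_nhds hρ₀)
  obtain ⟨b, hb⟩ := exists_ne a₀
  obtain ⟨m₁, hm₁⟩ := (Set.finite_range x).bddBelow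
  obtain ⟨m₂, hm₂⟩ := (Set.finite_range y).bddBelow
  set M : ℤ := N + 1 - min m₁ m₂ with hM
  obtain ⟨ρ, hρU, hρ⟩ := hN
    (fun _ => Finset.univ.image fun i => (x i + M, y i + M))
    (by
      intro _ p hp q hq
      obtain ⟨i, -, rfl⟩ := Finset.mem_image.1 hp
      obtain ⟨i', -, rfl⟩ := Finset.mem_image.1 hq
      simp [hx.eq_iff, hy.eq_iff])
    (by
      intro _ p hp
      obtain ⟨i, -, rfl⟩ := Finset.mem_image.1 hp
      have h1 : m₁ ≤ x i := hm₁ (Set.mem_range_self i)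
      have h2 : m₂ ≤ y i := hm₂ (Set.mem_range_self i)
      constructor <;> simp only <;> omega)
  refine ⟨ρ, hρU,
    FreeGroup.of a₀ ^ (-M) * (FreeGroup.of b * FreeGroup.of a₀ ^ M), fun i => ?_⟩
  have h := (hρ b hb).2 _ (Finset.mem_image.2 ⟨i, Finset.mem_univ i, rfl⟩)
  simp only at h
  rw [map_mul, map_mul, map_zpow, map_zpow, ρ.2, Equiv.Perm.mul_apply, Equiv.Perm.mul_apply,
    shiftPerm_zpow_apply, shiftPerm_zpow_apply, h]
  ring

/-- If the free generators are finitely supported, every element is a translation near `+∞`. -/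
theorem HomSigma.eventually_translation (ρ : HomSigma a₀)
    (hρ : ∀ b, b ≠ a₀ → {n | ρ.1 (FreeGroup.of b) n ≠ n}.Finite) (γ : FreeGroup ι) :
    ∃ e : ℤ, ∀ᶠ n in atTop, ρ.1 γ n = n + e := by
  have hgen : ∀ b, ∃ e : ℤ, ∀ᶠ n in atTop, ρ.1 (FreeGroup.of b) n = n + e := by
    intro b
    by_cases hb : b = a₀
    · exact ⟨1, Eventually.of_forall fun n => by rw [hb, ρ.2]; rfl⟩
    · obtain ⟨K, hK⟩ := (hρ b hb).bddAbove
      refine ⟨0, (eventually_gt_atTop K).mono fun n hn => ?_⟩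
      by_contra h
      exact absurd (hK (show n ∈ {n | ρ.1 (FreeGroup.of b) n ≠ n} by simpa using h)) (not_le.2 hn)
  induction γ using FreeGroup.induction_on with
  | C1 => exact ⟨0, by simp⟩
  | of b => exact hgen b
  | inv_of b _ =>
    obtain ⟨e, he⟩ := hgen b
    refine ⟨-e, ?_⟩
    filter_upwards [(tendsto_atTop_add_const_right atTop (-e) tendsto_id).eventually he] with n hn
    rw [map_inv, Equiv.Perm.inv_eq_iff_eq]
    simp only [id] at hn
    rw [hn]
    ring
  | mul g h hg hh =>
    obtain ⟨e, he⟩ := hg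
    obtain ⟨e', he'⟩ := hh
    refine ⟨e' + e, ?_⟩
    filter_upwards [he', (tendsto_atTop_add_const_right atTop e' tendsto_id).eventually he]
      with n h1 h2
    simp only [id] at h2
    rw [map_mul, Equiv.Perm.mul_apply, h1, h2]
    ring

theorem ncard_image_symmDiff_Ico_le {g : Equiv.Perm ℤ} {K L e : ℤ} {E : ℕ} (he : |e| ≤ E)
    (hg : ∀ n, K ≤ n → g n = n + e) :
    ((g '' Set.Ico K (K + L)) ∆ Set.Ico K (K + L)).ncard ≤ 2 * (2 * E + 1) := by
  have himg : g '' Set.Ico K (K + L) = Set.Ico (K + e) (K + L + e) := by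
    rw [Set.image_congr (g := fun n => n + e) fun n hn => hg n hn.1, Set.image_add_const_Ico]
  have hsub : (g '' Set.Ico K (K + L)) ∆ Set.Ico K (K + L) ⊆
      ↑(Finset.Icc (K - E) (K + E) ∪ Finset.Icc (K + L - E) (K + L + E)) := by
    rw [himg]
    intro n hn
    have := abs_le.1 he
    simp only [Set.mem_symmDiff, Set.mem_Ico, not_and, not_lt] at hn
    simp only [Finset.coe_union, Finset.coe_Icc, Set.mem_union, Set.mem_Icc]
    omega
  refine (Set.ncard_le_ncard hsub (Finset.finite_toSet _)).trans ?_
  rw [Set.ncard_coe_finset]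
  refine (Finset.card_union_le _ _).trans ?_
  rw [Int.card_Icc, Int.card_Icc]
  omega

theorem HomSigma.dense_folner (F : Finset (FreeGroup ι)) {ε : ℝ} (hε : 0 < ε) :
    Dense {ρ : HomSigma a₀ | ∃ A : Set ℤ, A.Finite ∧ A.Nonempty ∧
      ∀ γ ∈ F, (((⇑(ρ.1 γ) '' A) ∆ A).ncard : ℝ) < ε * A.ncard} := by
  classical
  refine dense_iff_inter_open.2 fun U hU ⟨ρ₀, hρ₀⟩ => ?_
  obtain ⟨N, hN⟩ := HomSigma.exists_mem_of_constraints (hU.mem_nhds hρ₀)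
  obtain ⟨ρ, hρU, hρ⟩ := hN (fun _ => ∅) (by simp) (by simp)
  choose e he using ρ.eventually_translation fun b hb => (hρ b hb).1
  obtain ⟨K, hK⟩ := eventually_atTop.1
    ((eventually_all_finset F).2 fun γ _ => he γ)
  set E : ℕ := F.sup fun γ => (e γ).natAbs
  obtain ⟨L, hL⟩ := exists_nat_gt (((2 * (2 * E + 1) : ℕ) : ℝ) / ε)
  have hL0 : 0 < L := by
    have : (0 : ℝ) < L := lt_of_le_of_lt (by positivity) hL
    exact_mod_cast this
  refine ⟨ρ, hρU, Set.Ico K (K + L), Set.finite_Ico _ _, ⟨K, by simp [hL0]⟩, fun γ hγ => ?_⟩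
  have hcard : (Set.Ico K (K + L)).ncard = L := by
    rw [← Finset.coe_Ico, Set.ncard_coe_finset, Int.card_Ico]
    simp
  have hle : |e γ| ≤ E := by
    rw [Int.abs_eq_natAbs]
    exact_mod_cast Finset.le_sup (f := fun γ => (e γ).natAbs) hγ
  have hbound := ncard_image_symmDiff_Ico_le (L := L) hle fun n hn => hK n hn γ hγ
  rw [hcard]
  calc _ ≤ ((2 * (2 * E + 1) : ℕ) : ℝ) := by exact_mod_cast hbound
    _ < ε * L := by rwa [div_lt_iff₀' hε] at hL

theorem HomSigma.isOpen_apply_ne (γ : FreeGroup ι) :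
    IsOpen {ρ : HomSigma a₀ | ∃ n, ρ.1 γ n ≠ n} := by
  simp only [Set.ofPred_exists]
  exact isOpen_iUnion fun n =>
    (isOpen_discrete {n}ᶜ).preimage (HomSigma.continuous_apply γ n)

theorem HomSigma.isOpen_map_tuple {k : ℕ} (x y : Fin k → ℤ) :
    IsOpen {ρ : HomSigma a₀ | ∃ γ : FreeGroup ι, ∀ i, ρ.1 γ (x i) = y i} := by
  simp only [Set.ofPred_exists, Set.ofPred_forall]
  exact isOpen_iUnion fun γ => isOpen_iInter_of_finite fun i => HomSigma.isOpen_apply_eq γ _ _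

theorem HomSigma.isOpen_folner (F : Finset (FreeGroup ι)) (ε : ℝ) :
    IsOpen {ρ : HomSigma a₀ | ∃ A : Set ℤ, A.Finite ∧ A.Nonempty ∧
      ∀ γ ∈ F, (((⇑(ρ.1 γ) '' A) ∆ A).ncard : ℝ) < ε * A.ncard} := by
  refine isOpen_iff_mem_nhds.2 fun ρ ⟨A, hA, hne, h⟩ => ?_
  have : ∀ᶠ ρ' : HomSigma a₀ in nhds ρ, ∀ γ ∈ F, ∀ n ∈ A, ρ'.1 γ n = ρ.1 γ n :=
    (eventually_all_finset F).2 fun γ _ => (eventually_all_finite hA).2 fun n _ =>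
      (HomSigma.isOpen_apply_eq γ n (ρ.1 γ n)).mem_nhds rfl
  filter_upwards [this] with ρ' hρ'
  refine ⟨A, hA, hne, fun γ hγ => ?_⟩
  rw [Set.image_congr (hρ' γ hγ)]
  exact h γ hγ

end HomSigma

/-- **Generic constrained representations are faithful, highly transitive and amenable.**
For a generic `ρ ∈ Hom_σ(Γ, Sym(ℤ))` (`Γ` free with basis `(a₀, b₁, b₂, …)`), the action of
`Γ` on `ℤ` via `ρ` is faithful, highly transitive (transitive on ordered tuples of pairwise
distinct integers of any length `k ≥ 1`), and amenable in the sense of Greenleaf (it admits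
`(F, ε)`-Følner sets for every finite `F ⊆ Γ` and every `ε > 0`). -/
theorem generic_faithful_highlyTransitive_amenable
    {ι : Type*} [Countable ι] [Nontrivial ι] (a₀ : ι) :
    {ρ : HomSigma a₀ |
        Function.Injective ρ.1 ∧
        (∀ k : ℕ, 1 ≤ k → ∀ x y : Fin k → ℤ,
          Function.Injective x → Function.Injective y →
            ∃ γ : FreeGroup ι, ∀ i, ρ.1 γ (x i) = y i) ∧
        (∀ F : Finset (FreeGroup ι), ∀ ε : ℝ, 0 < ε →
          ∃ A : Set ℤ, A.Finite ∧ A.Nonempty ∧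
            ∀ γ ∈ F, (((⇑(ρ.1 γ) '' A) ∆ A).ncard : ℝ) < ε * A.ncard)}
      ∈ residual (HomSigma a₀) := by
  have hfaithful : ∀ᶠ ρ : HomSigma a₀ in residual (HomSigma a₀),
      ∀ γ : {γ : FreeGroup ι // γ ≠ 1}, ∃ n, ρ.1 γ n ≠ n :=
    eventually_countable_forall.2 fun γ =>
      residual_of_dense_open (HomSigma.isOpen_apply_ne γ.1) (HomSigma.dense_apply_ne γ.2)
  have htransitive : ∀ᶠ ρ : HomSigma a₀ in residual (HomSigma a₀),
      ∀ (k : ℕ) (x y : {x : Fin k → ℤ // Function.Injective x}),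
        ∃ γ : FreeGroup ι, ∀ i, ρ.1 γ (x.1 i) = y.1 i :=
    eventually_countable_forall.2 fun k => eventually_countable_forall.2 fun x =>
      eventually_countable_forall.2 fun y =>
        residual_of_dense_open (HomSigma.isOpen_map_tuple x.1 y.1)
          (HomSigma.dense_map_tuple x.2 y.2)
  have hamenable : ∀ᶠ ρ : HomSigma a₀ in residual (HomSigma a₀),
      ∀ (F : Finset (FreeGroup ι)) (m : ℕ), ∃ A : Set ℤ, A.Finite ∧ A.Nonempty ∧
        ∀ γ ∈ F, (((⇑(ρ.1 γ) '' A) ∆ A).ncard : ℝ) < 1 / ((m : ℝ) + 1) * A.ncard :=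
    eventually_countable_forall.2 fun F => eventually_countable_forall.2 fun m =>
      residual_of_dense_open (HomSigma.isOpen_folner F _)
        (HomSigma.dense_folner F Nat.one_div_pos_of_nat)
  filter_upwards [hfaithful, htransitive, hamenable] with ρ h1 h2 h3
  refine ⟨(injective_iff_map_eq_one ρ.1).2 fun γ hγ => ?_, fun k _ x y hx hy => ?_,
    fun F ε hε => ?_⟩
  · by_contra hne
    obtain ⟨n, hn⟩ := h1 ⟨γ, hne⟩
    exact hn (by rw [hγ, Equiv.Perm.one_apply])
  · exact h2 k ⟨x, hx⟩ ⟨y, hy⟩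
  · obtain ⟨m, hm⟩ := exists_nat_one_div_lt hε
    obtain ⟨A, hA, hne, hF⟩ := h3 F m
    exact ⟨A, hA, hne, fun γ hγ => (hF γ hγ).trans_le
      (mul_le_mul_of_nonneg_right hm.le (Nat.cast_nonneg _))⟩
end
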